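/- Consider the binomial graph B12, the digraph on vertex set ZMod 12 with an edge from i to j if and only if j − i ∈ {1, 2, 4, 8, 10, 11} (i.e., j = i ± 1, i ± 2, or i ± 4 modulo 12). Then there exist six pairwise internally disjoint paths from vertex 0 to vertex 3, each of length at most 4; moreover, every family of six pairwise internally disjoint paths from 0 to 3 contains a path of length at least 3. Consequently, the min-max value δ_5 for six disjoint paths from 0 to 3 satisfies 3 ≤ δ_5 ≤ 4. -/

import Mathlib

/-- The binomial graph on 12 vertices: an edge from `i` to `j` iff
`j − i ∈ {±1, ±2, ±4} = {1, 2, 4, 8, 10, 11}` in `ZMod 12`. -/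
def B12 (i j : ZMod 12) : Prop :=
  j - i ∈ ({1, 2, 4, 8, 10, 11} : Set (ZMod 12))

/-- A path of length `len` from `u` to `v` in the digraph `r`: a sequence of pairwise
distinct vertices starting at `u`, ending at `v`, following edges of `r`. -/
structure DiPath {V : Type*} (r : V → V → Prop) (u v : V) where
  len : ℕ
  vert : Fin (len + 1) → V
  first : vert 0 = u
  last : vert (Fin.last len) = v
  inj : Function.Injective vert
  step : ∀ i : Fin len, r (vert i.castSucc) (vert i.succ)

/-- Two paths from `u` to `v` are internally disjoint if the only vertices they have in
common are `u` and `v`. -/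
def InternallyDisjoint {V : Type*} {r : V → V → Prop} {u v : V}
    (p q : DiPath r u v) : Prop :=
  ∀ a : V, (∃ i, p.vert i = a) → (∃ j, q.vert j = a) → a = u ∨ a = v

instance (i j : ZMod 12) : Decidable (B12 i j) :=
  decidable_of_iff (j - i ∈ ({1, 2, 4, 8, 10, 11} : Finset (ZMod 12))) (by
    simp [B12])

/-- Direct path of length two through `a`. -/
def pathTwo (a : ZMod 12) (h : B12 0 a ∧ B12 a 3 ∧ Function.Injective ![0, a, 3]) :
    DiPath B12 0 3 where
  len := 2
  vert := ![0, a, 3]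
  first := rfl
  last := rfl
  inj := h.2.2
  step := by
    intro i
    fin_cases i
    · exact h.1
    · exact h.2.1

/-- The path `0, 8, 7, 3`. -/
def pathThree : DiPath B12 0 3 where
  len := 3
  vert := ![0, 8, 7, 3]
  first := rfl
  last := rfl
  inj := by decide
  step := by decide

/-- The path `0, 10, 6, 5, 3`. -/
def pathFour : DiPath B12 0 3 where
  len := 4
  vert := ![0, 10, 6, 5, 3]
  first := rfl
  last := rfl
  inj := by decide
  step := by decide

/-- The six paths. -/
def sixPaths : Fin 6 → DiPath B12 0 3 :=
  ![pathTwo 1 (by decide), pathTwo 2 (by decide), pathTwo 4 (by decide),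
    pathTwo 11 (by decide), pathThree, pathFour]

theorem short_path_mid (p : DiPath B12 0 3) (h : p.len < 3) :
    ∃ a ∈ ({1, 2, 4, 11} : Finset (ZMod 12)), ∃ i, p.vert i = a := by
  obtain ⟨len, vert, first, last, inj, step⟩ := p
  dsimp only at h ⊢
  interval_cases len
  · have : (0 : ZMod 12) = 3 := first.symm.trans last
    exact absurd this (by decide)
  · have h0 : B12 (vert 0) (vert (Fin.last 1)) := step 0
    rw [first, last] at h0
    exact absurd h0 (by decide)
  · have h0 : B12 (vert 0) (vert 1) := step 0
    have h1 : B12 (vert 1) (vert (Fin.last 2)) := step 1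
    rw [first] at h0
    rw [last] at h1
    have key : ∀ a : ZMod 12, B12 0 a → B12 a 3 →
        a ∈ ({1, 2, 4, 11} : Finset (ZMod 12)) := by decide
    exact ⟨vert 1, key _ h0 h1, 1, rfl⟩

/-- In `B12` there exist six pairwise internally disjoint paths from `0` to
`3`, each of length at most 4; moreover, every family of six pairwise internally disjoint
paths from `0` to `3` contains a path of length at least 3.  Hence `3 ≤ δ₅ ≤ 4`. -/
theorem b12_six_disjoint_paths :
    (∃ p : Fin 6 → DiPath B12 0 3,
        (∀ i j : Fin 6, i ≠ j → InternallyDisjoint (p i) (p j)) ∧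
          ∀ i, (p i).len ≤ 4) ∧
      (∀ p : Fin 6 → DiPath B12 0 3,
        (∀ i j : Fin 6, i ≠ j → InternallyDisjoint (p i) (p j)) →
          ∃ i, 3 ≤ (p i).len) := by
  refine ⟨⟨sixPaths, ?_, by decide⟩, ?_⟩
  · unfold InternallyDisjoint
    intro i j
    fin_cases i <;> fin_cases j <;> decide
  · intro p hp
    by_contra! hlt
    choose f hf hv using fun i => short_path_mid (p i) (hlt i)
    obtain ⟨i, -, j, -, hij, he⟩ := Finset.exists_ne_map_eq_of_card_lt_of_maps_to
      (s := Finset.univ) (t := ({1, 2, 4, 11} : Finset (ZMod 12))) (f := f)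
      (by decide) (fun i _ => hf i)
    have hd := hp i j hij (f i) (hv i) (he ▸ hv j)
    have key : ∀ a ∈ ({1, 2, 4, 11} : Finset (ZMod 12)), ¬ (a = 0 ∨ a = 3) := by decide
    exact key _ (hf i) hd
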